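/- Let p, q be integers with 1 < p < q, set n = p+q−1, and let ε ∈ ℚⁿ be the vector with ε_j = 1 if j ≤ p or j ≥ q, and ε_j = 0 otherwise. Then the vector d ∈ ℚⁿ with entries d_i = i(2p+1−i) for 1 ≤ i ≤ p, d_i = p(p+1) for p ≤ i ≤ q, and d_i = (p+q−i)(i+p−q+1) for q ≤ i ≤ n satisfies C·d = 2·ε, where C is the Cartan matrix of type A_n; equivalently d = 2·C⁻¹·ε. Thus d is the vector of degrees of the Iwasawa polynomials of the symmetric space SU(p,q)/S(U(p)×U(q)) in the fundamental representations. -/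

import Mathlib

open Matrix

/-- The Cartan matrix of type `Aₙ`. -/
def cartanA (n : ℕ) : Matrix (Fin n) (Fin n) ℚ :=
  Matrix.of fun i j =>
    if i = j then 2
    else if i.val + 1 = j.val ∨ j.val + 1 = i.val then -1
    else 0

/-- The Satake vector of `SU(p,q)/S(U(p)×U(q))` with `1 < p < q` (type AIIIₐ):
`εⱼ = 1` iff `j ≤ p` or `j ≥ q` (1-based indices as `Fin (p+q-1)`). -/
def satakeAIII (p q n : ℕ) : Fin n → ℚ :=
  fun m => if m.val + 1 ≤ p ∨ q ≤ m.val + 1 then 1 else 0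

/-- The degrees of the Iwasawa polynomials of `SU(p,q)/S(U(p)×U(q))` in the fundamental
representations: `dᵢ = i(2p+1-i)` for `i ≤ p`, `dᵢ = p(p+1)` for `p ≤ i ≤ q`, and
`dᵢ = (p+q-i)(i+p-q+1)` for `q ≤ i ≤ p+q-1`. -/
def degSUpq (p q n : ℕ) : Fin n → ℚ :=
  fun m =>
    if m.val + 1 ≤ p then ((m.val : ℚ) + 1) * (2 * (p : ℚ) + 1 - ((m.val : ℚ) + 1))
    else if m.val + 1 ≤ q then (p : ℚ) * ((p : ℚ) + 1)
    else ((p : ℚ) + (q : ℚ) - ((m.val : ℚ) + 1)) *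
      (((m.val : ℚ) + 1) + (p : ℚ) - (q : ℚ) + 1)

theorem cartanA_aux (n : ℕ) (f : ℕ → ℚ) (h0 : f 0 = 0) (hn : f (n + 1) = 0) (i : Fin n) :
    (cartanA n).mulVec (fun m => f (m.val + 1)) i
      = 2 * f (i.val + 1) - f i.val - f (i.val + 2) := by
  have h1 : ∀ j : Fin n, cartanA n i j * f (j.val + 1) =
      (fun k : ℕ => (if i.val = k then 2 * f (k + 1) else 0)
        - (if i.val + 1 = k then f (k + 1) else 0)
        - (if k + 1 = i.val then f (k + 1) else 0)) j.val := by
    intro j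
    simp only [cartanA, Matrix.of_apply, Fin.ext_iff]
    split_ifs <;> first | omega | ring
  simp only [Matrix.mulVec, dotProduct]
  rw [Finset.sum_congr rfl (fun j _ => h1 j), Fin.sum_univ_eq_sum_range (fun k : ℕ => (if i.val = k then 2 * f (k + 1) else 0)
        - (if i.val + 1 = k then f (k + 1) else 0)
        - (if k + 1 = i.val then f (k + 1) else 0)) n,
    Finset.sum_sub_distrib, Finset.sum_sub_distrib]
  have hi := i.isLt
  have e1 : ∑ k ∈ Finset.range n, (if i.val = k then 2 * f (k + 1) else 0)
      = 2 * f (i.val + 1) := by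
    rw [Finset.sum_ite_eq]; simp
  have e2 : ∑ k ∈ Finset.range n, (if i.val + 1 = k then f (k + 1) else 0)
      = f (i.val + 2) := by
    rw [Finset.sum_ite_eq]
    split_ifs with h
    · rfl
    · have : i.val + 2 = n + 1 := by
        simp only [Finset.mem_range] at h; omega
      rw [this, hn]
  have e3 : ∑ k ∈ Finset.range n, (if k + 1 = i.val then f (k + 1) else 0)
      = f i.val := by
    obtain ⟨m, hm⟩ := i
    cases m with
    | zero => simp [h0]
    | succ m =>
      simp only [Nat.add_right_cancel_iff]
      rw [Finset.sum_ite_eq', if_pos (by simp; omega)]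
  rw [e1, e2, e3]; ring

theorem cartanA_isUnit (n : ℕ) : IsUnit (cartanA n) := by
  rw [← Matrix.mulVec_injective_iff_isUnit]
  have key : ∀ v : Fin n → ℚ, (cartanA n).mulVec v = 0 → v = 0 := by
    intro v hv
    let f : ℕ → ℚ := fun k => if h : 0 < k ∧ k - 1 < n then v ⟨k - 1, h.2⟩ else 0
    have h0 : f 0 = 0 := by simp [f]
    have hn : f (n + 1) = 0 := by simp [f]
    have hvf : v = fun m : Fin n => f (m.val + 1) := by
      funext m; simp [f]
    have hrec : ∀ k, k < n → f (k + 2) = 2 * f (k + 1) - f k := by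
      intro k hk
      have h := cartanA_aux n f h0 hn ⟨k, hk⟩
      rw [← hvf, hv] at h
      simp only [Pi.zero_apply] at h
      linarith
    have lin : ∀ k, k ≤ n → f k = k * f 1 ∧ f (k + 1) = (k + 1) * f 1 := by
      intro k
      induction k with
      | zero => intro _; simp [h0]
      | succ k ih =>
        intro hk
        obtain ⟨a, b⟩ := ih (by omega)
        have := hrec k (by omega)
        push_cast
        refine ⟨b, ?_⟩
        rw [show k + 1 + 1 = k + 2 from rfl, this, a, b]; ring
    have f1 : f 1 = 0 := by
      have h := (lin n le_rfl).2
      rw [hn] at h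
      rcases mul_eq_zero.mp h.symm with h | h
      · have : (0 : ℚ) ≤ n := Nat.cast_nonneg n
        linarith
      · exact h
    rw [hvf]; funext m
    have := (lin m.val m.isLt.le).2
    simp [this, f1]
  intro a b hab
  have := key (a - b) (by rw [Matrix.mulVec_sub]; exact sub_eq_zero.mpr hab)
  exact sub_eq_zero.mp this

theorem iwasawa_degrees_SUpq (p q : ℕ) (hp : 1 < p) (hpq : p < q) (n : ℕ)
    (hn : n = p + q - 1) :
    (cartanA n).mulVec (degSUpq p q n) = (2 : ℚ) • satakeAIII p q n ∧
      degSUpq p q n = (2 : ℚ) • (cartanA n)⁻¹.mulVec (satakeAIII p q n) := by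
  have main : (cartanA n).mulVec (degSUpq p q n) = (2 : ℚ) • satakeAIII p q n := by
    let f : ℕ → ℚ := fun k =>
      if k ≤ p then (k : ℚ) * (2 * (p : ℚ) + 1 - (k : ℚ))
      else if k ≤ q then (p : ℚ) * ((p : ℚ) + 1)
      else ((p : ℚ) + (q : ℚ) - (k : ℚ)) * ((k : ℚ) + (p : ℚ) - (q : ℚ) + 1)
    have hd : degSUpq p q n = fun m : Fin n => f (m.val + 1) := by
      funext m; simp [f, degSUpq]
    have h0 : f 0 = 0 := by simp [f]
    have hn1 : f (n + 1) = 0 := by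
      have : n + 1 = p + q := by omega
      rw [this]
      simp only [f]
      rw [if_neg (by omega), if_neg (by omega)]
      push_cast; ring
    funext i
    rw [hd, cartanA_aux n f h0 hn1]
    obtain ⟨k, hk⟩ := i
    have fA : ∀ k, k ≤ p → f k = (k : ℚ) * (2 * (p : ℚ) + 1 - (k : ℚ)) := by
      intro k hk; simp only [f]; rw [if_pos hk]
    have fB : ∀ k, p ≤ k → k ≤ q → f k = (p : ℚ) * ((p : ℚ) + 1) := by
      intro k hk hk'
      rcases hk.eq_or_lt with h | h
      · subst h; rw [fA _ le_rfl]; ring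
      · simp only [f]; rw [if_neg (by omega), if_pos hk']
    have fC : ∀ k, q ≤ k →
        f k = ((p : ℚ) + (q : ℚ) - (k : ℚ)) * ((k : ℚ) + (p : ℚ) - (q : ℚ) + 1) := by
      intro k hk
      rcases hk.eq_or_lt with h | h
      · subst h; rw [fB _ hpq.le le_rfl]; ring
      · simp only [f]; rw [if_neg (by omega), if_neg (by omega)]
    simp only [satakeAIII, Pi.smul_apply, smul_eq_mul]
    clear_value f
    rcases lt_trichotomy (k + 1) p with h | h | h
    · rw [fA k (by omega), fA (k + 1) (by omega), fA (k + 2) (by omega), if_pos (by omega)]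
      push_cast; ring
    · rw [fA k (by omega), fB (k + 1) (by omega) (by omega),
        fB (k + 2) (by omega) (by omega), if_pos (by omega), ← h]
      push_cast; ring
    · rcases lt_trichotomy (k + 1) q with h' | h' | h'
      · rw [fB k (by omega) (by omega), fB (k + 1) (by omega) (by omega),
          fB (k + 2) (by omega) (by omega), if_neg (by omega)]
        ring
      · rw [fB k (by omega) (by omega), fB (k + 1) (by omega) (by omega),
          fC (k + 2) (by omega), if_pos (by omega), ← h']
        push_cast; ring
      · rw [fC k (by omega), fC (k + 1) (by omega), fC (k + 2) (by omega), if_pos (by omega)]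
        push_cast; ring
  refine ⟨main, ?_⟩
  have hu : IsUnit (cartanA n).det := (Matrix.isUnit_iff_isUnit_det _).mp (cartanA_isUnit n)
  rw [← Matrix.mulVec_smul, ← main, Matrix.mulVec_mulVec, Matrix.nonsing_inv_mul _ hu,
    Matrix.one_mulVec]
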